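/- Let H, j, N, A, B, Q_σ, λ_j(σ) be as in the min–max setting. Assume there exists a j-dimensional subspace E₀ of H such that B(u) = 0 for all u ∈ E₀ and S := sup { A(u)/‖u‖² : u ∈ E₀, u ≠ 0 } is finite. Define λ̄_j : [0,1] → ℝ by λ̄_j(σ) = λ_j(σ) for σ ∈ [0,1) and λ̄_j(1) = 0. Then λ̄_j is real-valued and Lipschitz continuous on [0,1]; in fact |λ̄_j(σ₁) − λ̄_j(σ₂)| ≤ (1+N)·S·|σ₁−σ₂| for all σ₁, σ₂ ∈ [0,1]. -/

import Mathlib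

open scoped ENNReal

/-- The `j`-th min–max value of a functional `Q` on a real inner product space. -/
noncomputable def minmaxVal {H : Type*} [NormedAddCommGroup H] [InnerProductSpace ℝ H]
    (j : ℕ) (Q : H → ℝ) : ℝ≥0∞ :=
  ⨅ (E : Submodule ℝ H) (_ : Module.finrank ℝ E = j),
    ⨆ (u : H) (_ : u ∈ E) (_ : u ≠ 0), ENNReal.ofReal (Q u / ‖u‖ ^ 2)

/-- A bound on the Rayleigh quotient over one `j`-dimensional subspace bounds the min–max value. -/
theorem minmaxVal_le_ofReal {H : Type*} [NormedAddCommGroup H] [InnerProductSpace ℝ H]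
    {j : ℕ} {Q : H → ℝ} {C : ℝ} (E : Submodule ℝ H) (hE : Module.finrank ℝ E = j)
    (h : ∀ u ∈ E, u ≠ 0 → Q u / ‖u‖ ^ 2 ≤ C) :
    minmaxVal j Q ≤ ENNReal.ofReal C :=
  (iInf₂_le E hE).trans <|
    iSup_le fun u => iSup₂_le fun hu hu0 => ENNReal.ofReal_le_ofReal (h u hu hu0)

/-- Min–max values are monotone in the functional, up to a positive factor. -/
theorem minmaxVal_le_ofReal_mul {H : Type*} [NormedAddCommGroup H] [InnerProductSpace ℝ H]
    (j : ℕ) {Q Q' : H → ℝ} {c : ℝ} (hc : 0 < c) (h : ∀ u, Q' u ≤ c * Q u) :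
    minmaxVal j Q' ≤ ENNReal.ofReal c * minmaxVal j Q := by
  have hc0 : ENNReal.ofReal c ≠ 0 := by simpa using hc
  simp only [minmaxVal, ENNReal.mul_iInf_of_ne hc0 ENNReal.ofReal_ne_top, ENNReal.mul_iSup,
    ← ENNReal.ofReal_mul hc.le]
  gcongr with E hE u hu hu0
  rw [← mul_div_assoc]
  gcongr
  exact h u

/-- Abstract form of Theorem 3.1 of the paper: the eigenvalue `λ_j(σ)`, extended
at `σ = 1` by the value `0`, is Lipschitz continuous on `[0,1]`, with Lipschitz
constant `(1+N)·S`. -/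
theorem stmt_8 {H : Type*} [NormedAddCommGroup H] [InnerProductSpace ℝ H]
    (j : ℕ) (hj : 1 ≤ j) (hex : ∃ E : Submodule ℝ H, Module.finrank ℝ E = j)
    (N : ℕ) (hN : 1 ≤ N) (A B : H → ℝ)
    (hB : ∀ u, 0 ≤ B u) (hBA : ∀ u, B u ≤ (N : ℝ) * A u)
    (lam : ℝ → ℝ≥0∞)
    (hlam : ∀ σ, lam σ = minmaxVal j (fun u => (1 - σ) * A u + σ * B u))
    (E₀ : Submodule ℝ H) (hE₀ : Module.finrank ℝ E₀ = j)
    (hBE₀ : ∀ u ∈ E₀, B u = 0)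
    (Sfin : BddAbove {s : ℝ | ∃ u ∈ E₀, u ≠ 0 ∧ s = A u / ‖u‖ ^ 2})
    (S : ℝ) (hS : S = sSup {s : ℝ | ∃ u ∈ E₀, u ≠ 0 ∧ s = A u / ‖u‖ ^ 2})
    (lamBar : ℝ → ℝ)
    (hlamBar₁ : ∀ σ ∈ Set.Ico (0 : ℝ) 1, lamBar σ = (lam σ).toReal)
    (hlamBar₂ : lamBar 1 = 0) :
    (∀ σ ∈ Set.Ico (0 : ℝ) 1, lam σ < ⊤) ∧
      ∀ σ₁ ∈ Set.Icc (0 : ℝ) 1, ∀ σ₂ ∈ Set.Icc (0 : ℝ) 1,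
        |lamBar σ₁ - lamBar σ₂| ≤ (1 + (N : ℝ)) * S * |σ₁ - σ₂| := by
  have hN' : (1 : ℝ) ≤ N := by exact_mod_cast hN
  have hA : ∀ u, 0 ≤ A u := fun u =>
    nonneg_of_mul_nonneg_right ((hB u).trans (hBA u)) (by linarith)
  have hS0 : 0 ≤ S := by
    rw [hS]
    apply Real.sSup_nonneg
    rintro s ⟨u, -, -, rfl⟩
    exact div_nonneg (hA u) (sq_nonneg _)
  have hbound : ∀ σ ∈ Set.Ico (0 : ℝ) 1, lam σ ≤ ENNReal.ofReal ((1 - σ) * S) := by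
    intro σ hσ
    rw [hlam]
    refine minmaxVal_le_ofReal E₀ hE₀ fun u hu hu0 => ?_
    rw [hBE₀ u hu, mul_zero, add_zero, mul_div_assoc, hS]
    exact mul_le_mul_of_nonneg_left (le_csSup Sfin ⟨u, hu, hu0, rfl⟩) (by linarith [hσ.2])
  have hfin : ∀ σ ∈ Set.Ico (0 : ℝ) 1, lam σ < ⊤ := fun σ hσ =>
    (hbound σ hσ).trans_lt ENNReal.ofReal_lt_top
  have hbar : ∀ σ ∈ Set.Ico (0 : ℝ) 1, 0 ≤ lamBar σ ∧ lamBar σ ≤ (1 - σ) * S := by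
    intro σ hσ
    rw [hlamBar₁ σ hσ]
    exact ⟨ENNReal.toReal_nonneg,
      ENNReal.toReal_le_of_le_ofReal (mul_nonneg (by linarith [hσ.2]) hS0) (hbound σ hσ)⟩
  have hstep : ∀ σ ∈ Set.Ico (0 : ℝ) 1, ∀ τ ∈ Set.Ico (0 : ℝ) 1,
      lamBar τ ≤ lamBar σ + N * S * |σ - τ| := by
    intro σ hσ τ hτ
    have hpos : 0 < 1 - σ := by linarith [hσ.2]
    set k : ℝ := N * |σ - τ| / (1 - σ) with hk
    have hk0 : 0 ≤ k := by positivity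
    have hkmul : k * (1 - σ) = N * |σ - τ| := div_mul_cancel₀ _ hpos.ne'
    have hle : lam τ ≤ ENNReal.ofReal (1 + k) * lam σ := by
      rw [hlam, hlam]
      refine minmaxVal_le_ofReal_mul j (by linarith) fun u => ?_
      have hAB : |A u - B u| ≤ N * A u := by
        rw [abs_le]
        constructor <;> nlinarith [hA u, hB u, hBA u]
      have h1 : (σ - τ) * (A u - B u) ≤ |σ - τ| * (N * A u) :=
        (le_abs_self _).trans <| by
          rw [abs_mul]
          exact mul_le_mul_of_nonneg_left hAB (abs_nonneg _)
      have h2 : 0 ≤ k * (σ * B u) := mul_nonneg hk0 (mul_nonneg hσ.1 (hB u))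
      have h3 : k * ((1 - σ) * A u) = |σ - τ| * (N * A u) := by
        rw [← mul_assoc, hkmul]
        ring
      linarith
    have hreal : lamBar τ ≤ (1 + k) * lamBar σ := by
      rw [hlamBar₁ τ hτ, hlamBar₁ σ hσ]
      have := ENNReal.toReal_mono
        (ENNReal.mul_ne_top ENNReal.ofReal_ne_top (hfin σ hσ).ne) hle
      rwa [ENNReal.toReal_mul, ENNReal.toReal_ofReal (by linarith)] at this
    have h4 : k * lamBar σ ≤ N * S * |σ - τ| :=
      calc k * lamBar σ ≤ k * ((1 - σ) * S) := mul_le_mul_of_nonneg_left (hbar σ hσ).2 hk0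
        _ = N * S * |σ - τ| := by
          rw [← mul_assoc, hkmul]
          ring
    linarith
  have hone : ∀ σ ∈ Set.Ico (0 : ℝ) 1, |lamBar σ| ≤ (1 + (N : ℝ)) * S * (1 - σ) := by
    intro σ hσ
    rw [abs_of_nonneg (hbar σ hσ).1]
    have : 0 ≤ N * S * (1 - σ) := mul_nonneg (by positivity) (by linarith [hσ.2])
    linarith [(hbar σ hσ).2]
  refine ⟨hfin, fun σ hσ τ hτ => ?_⟩
  rcases hσ.2.eq_or_lt with rfl | hσ1 <;> rcases hτ.2.eq_or_lt with rfl | hτ1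
  · simp
  · rw [hlamBar₂, zero_sub, abs_neg, abs_of_pos (sub_pos.2 hτ1)]
    exact hone τ ⟨hτ.1, hτ1⟩
  · rw [hlamBar₂, sub_zero, abs_sub_comm, abs_of_pos (sub_pos.2 hσ1)]
    exact hone σ ⟨hσ.1, hσ1⟩
  · have h1 := hstep σ ⟨hσ.1, hσ1⟩ τ ⟨hτ.1, hτ1⟩
    have h2 := hstep τ ⟨hτ.1, hτ1⟩ σ ⟨hσ.1, hσ1⟩
    rw [abs_sub_comm τ σ] at h2
    have h3 : 0 ≤ S * |σ - τ| := by positivity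
    rw [abs_le]
    constructor <;> linarith
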